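/- Let L = sl_2 ∔ I be the complex (m+4)-dimensional simple Leibniz algebra of Theorem 2.3 with m ≥ 2. Then HL^2(L,L) = 0, i.e., every Leibniz 2-cocycle of L with coefficients in itself is a Leibniz 2-coboundary. -/

import Mathlib

open Finset

/-- Basis index type: `Sum.inl 0 = e`, `Sum.inl 1 = f`, `Sum.inl 2 = h`,
`Sum.inr k = x_k`. -/
abbrev BasisIdx (m : ℕ) : Type := Fin 3 ⊕ Fin (m + 1)

/-- The underlying vector space of the `(m+4)`-dimensional algebra. -/
def Lm (m : ℕ) : Type := BasisIdx m → ℂ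

noncomputable instance (m : ℕ) : AddCommGroup (Lm m) := Pi.addCommGroup
noncomputable instance (m : ℕ) : Module ℂ (Lm m) := Pi.module _ _ _
instance (m : ℕ) : FiniteDimensional ℂ (Lm m) := Module.Finite.pi (ι := BasisIdx m)

/-- The basis vectors. -/
noncomputable def bas (m : ℕ) (i : BasisIdx m) : Lm m := Pi.single i 1

/-- Structure constants of the simple Leibniz algebra with associated Lie algebra
`sl₂`:  `[x_k,e] = -k(m+1-k)x_{k-1}`, `[x_k,f] = x_{k+1}`, `[x_k,h] = (m-2k)x_k`,
`[e,h] = 2e = -[h,e]`, `[h,f] = 2f = -[f,h]`, `[e,f] = h = -[f,e]`,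
all other products of basis vectors being zero. -/
noncomputable def sc (m : ℕ) : BasisIdx m → BasisIdx m → Lm m
  | Sum.inr k, Sum.inl ⟨0, _⟩ =>
      (-((k : ℂ) * ((m : ℂ) + 1 - (k : ℂ)))) •
        bas m (Sum.inr ⟨(k : ℕ) - 1, Nat.lt_of_le_of_lt (Nat.sub_le _ _) k.isLt⟩)
  | Sum.inr k, Sum.inl ⟨1, _⟩ =>
      if h : (k : ℕ) < m then bas m (Sum.inr ⟨(k : ℕ) + 1, by omega⟩) else 0
  | Sum.inr k, Sum.inl ⟨2, _⟩ => ((m : ℂ) - 2 * (k : ℂ)) • bas m (Sum.inr k)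
  | Sum.inl ⟨0, _⟩, Sum.inl ⟨2, _⟩ => (2 : ℂ) • bas m (Sum.inl 0)
  | Sum.inl ⟨2, _⟩, Sum.inl ⟨0, _⟩ => (-2 : ℂ) • bas m (Sum.inl 0)
  | Sum.inl ⟨2, _⟩, Sum.inl ⟨1, _⟩ => (2 : ℂ) • bas m (Sum.inl 1)
  | Sum.inl ⟨1, _⟩, Sum.inl ⟨2, _⟩ => (-2 : ℂ) • bas m (Sum.inl 1)
  | Sum.inl ⟨0, _⟩, Sum.inl ⟨1, _⟩ => bas m (Sum.inl 2)
  | Sum.inl ⟨1, _⟩, Sum.inl ⟨0, _⟩ => -bas m (Sum.inl 2)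
  | _, _ => 0

/-- The bilinear bracket of the algebra, extended from the structure constants. -/
noncomputable def br (m : ℕ) (x y : Lm m) : Lm m :=
  ∑ i : BasisIdx m, ∑ j : BasisIdx m, (x i * y j) • sc m i j

section SlTwoOperators

variable {M : Type*} [AddCommGroup M] [Module ℂ M]

/-- Operators `E`, `F`, `H` defining a right module over `sl₂` with `[e,h] = 2e`, `[h,f] = 2f`,
`[e,f] = h`. -/
structure IsSlTwoRightAction (E F H : Module.End ℂ M) : Prop where
  HE : ∀ v, H (E v) = E (H v) + (2 : ℂ) • E v
  HF : ∀ v, H (F v) = F (H v) - (2 : ℂ) • F v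
  FE : ∀ v, F (E v) = E (F v) + H v

/-- The Casimir operator `H² / 2 + H - 2 F E`. -/
noncomputable def casimir (E F H : Module.End ℂ M) : Module.End ℂ M :=
  (1 / 2 : ℂ) • (H * H) + H - (2 : ℂ) • (F * E)

/-- An operator shifting the eigenvalues of `H` by a nonzero constant kills some iterate of any
eigenvector. -/
theorem exists_last_pow_ne_zero [FiniteDimensional ℂ M] {E H : Module.End ℂ M} {s : ℂ} (hs : s ≠ 0)
    (hE : ∀ v, H (E v) = E (H v) + s • E v) {v : M} (hv : v ≠ 0) {μ : ℂ} (hμ : H v = μ • v) :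
    ∃ k : ℕ, ∃ u : M, u ≠ 0 ∧ E u = 0 ∧ H u = (μ + k * s) • u ∧ u = (E ^ k) v := by
  have hw : ∀ k : ℕ, H ((E ^ k) v) = (μ + k * s) • (E ^ k) v := by
    intro k
    induction k with
    | zero => simpa using hμ
    | succ k ih =>
      rw [pow_succ', Module.End.mul_apply, hE, ih, map_smul, ← add_smul]
      push_cast
      ring_nf
  have hex : ∃ k : ℕ, (E ^ k) v = 0 := by
    by_contra! hne
    have hfin := Module.End.finite_hasEigenvalue H
    refine Set.infinite_of_injective_forall_mem (f := fun k : ℕ => μ + k * s) ?_ ?_ hfin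
    · intro a b hab
      simpa [hs] using hab
    · exact fun k => Module.End.hasEigenvalue_of_hasEigenvector
        ⟨Module.End.mem_eigenspace_iff.2 (hw k), hne k⟩
  classical
  obtain ⟨k, hk⟩ : ∃ k, Nat.find hex = k + 1 := by
    refine Nat.exists_eq_succ_of_ne_zero fun h0 => hv ?_
    simpa [h0] using Nat.find_spec hex
  refine ⟨k, (E ^ k) v, Nat.find_min hex (by omega), ?_, hw k, rfl⟩
  have := Nat.find_spec hex
  rwa [hk, pow_succ', Module.End.mul_apply] at this

namespace IsSlTwoRightAction

variable {E F H : Module.End ℂ M}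

theorem casimir_E (hA : IsSlTwoRightAction E F H) (v : M) :
    casimir E F H (E v) = E (casimir E F H v) := by
  simp only [casimir, LinearMap.sub_apply, LinearMap.add_apply, LinearMap.smul_apply,
    Module.End.mul_apply, map_sub, map_add, map_smul, hA.HE, hA.FE]
  module

theorem casimir_F (hA : IsSlTwoRightAction E F H) (v : M) :
    casimir E F H (F v) = F (casimir E F H v) := by
  simp only [casimir, LinearMap.sub_apply, LinearMap.add_apply, LinearMap.smul_apply,
    Module.End.mul_apply, map_sub, map_add, map_smul, hA.HF, hA.FE]
  module

theorem casimir_H (hA : IsSlTwoRightAction E F H) (v : M) :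
    casimir E F H (H v) = H (casimir E F H v) := by
  simp only [casimir, LinearMap.sub_apply, LinearMap.add_apply, LinearMap.smul_apply,
    Module.End.mul_apply, map_sub, map_add, map_smul, hA.HF, hA.HE]
  module

theorem casimir_eq (hA : IsSlTwoRightAction E F H) (v : M) :
    casimir E F H v = (1 / 2 : ℂ) • H (H v) - H v - (2 : ℂ) • E (F v) := by
  simp only [casimir, LinearMap.sub_apply, LinearMap.add_apply, LinearMap.smul_apply,
    Module.End.mul_apply, hA.FE]
  module

theorem eigenvalue_eq_zero [FiniteDimensional ℂ M] (hA : IsSlTwoRightAction E F H) {n : ℕ} {v : M}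
    (hn : (casimir E F H ^ n) v = 0) (hv : v ≠ 0) {μ : ℂ} (hμ : H v = μ • v) : μ = 0 := by
  have hpow : ∀ (X : Module.End ℂ M) (k : ℕ),
      Commute (casimir E F H) X → (casimir E F H ^ n) ((X ^ k) v) = 0 := by
    intro X k hX
    have := (hX.pow_pow n k).eq
    rw [← Module.End.mul_apply, this, Module.End.mul_apply, hn, map_zero]
  have heig : ∀ (u : M) (a : ℂ), u ≠ 0 → casimir E F H u = a • u →
      (casimir E F H ^ n) u = 0 → a = 0 := by
    intro u a hu ha h0
    have : (casimir E F H ^ n) u = a ^ n • u :=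
      (Module.End.HasEigenvector.pow_apply ⟨Module.End.mem_eigenspace_iff.2 ha, hu⟩ n)
    rw [this] at h0
    exact eq_zero_of_pow_eq_zero ((smul_eq_zero.1 h0).resolve_right hu)
  obtain ⟨k, u, hu, hEu, hHu, rfl⟩ := exists_last_pow_ne_zero (two_ne_zero) hA.HE hv hμ
  obtain ⟨l, w, hw, hFw, hHw, rfl⟩ := exists_last_pow_ne_zero (s := (-2 : ℂ)) (by norm_num)
    (fun v => by rw [hA.HF, neg_smul, sub_eq_add_neg]) hv hμ
  have h1 := heig _ ((1 / 2) * (μ + k * 2) ^ 2 + (μ + k * 2)) hu (by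
      simp only [casimir, LinearMap.sub_apply, LinearMap.add_apply, LinearMap.smul_apply,
        Module.End.mul_apply, hEu, hHu, map_smul, map_zero]
      module) (hpow E k (LinearMap.ext hA.casimir_E))
  have h2 := heig _ ((1 / 2) * (μ + l * (-2)) ^ 2 - (μ + l * (-2))) hw (by
      simp only [hA.casimir_eq, hFw, hHw, map_smul, map_zero]
      module) (hpow F l (LinearMap.ext hA.casimir_F))
  have h1' : (μ + k * 2) = 0 ∨ (μ + k * 2) = -2 := by
    have : (μ + k * 2) * (μ + k * 2 + 2) = 0 := by linear_combination 2 * h1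
    rcases mul_eq_zero.1 this with h | h
    · exact Or.inl h
    · exact Or.inr (by linear_combination h)
  have h2' : (μ + l * (-2)) = 0 ∨ (μ + l * (-2)) = 2 := by
    have : (μ + l * (-2)) * (μ + l * (-2) - 2) = 0 := by linear_combination 2 * h2
    rcases mul_eq_zero.1 this with h | h
    · exact Or.inl h
    · exact Or.inr (by linear_combination h)
  have hk : (k : ℂ) = 0 := by
    have hkl : ∃ j : ℕ, ((k + l + j : ℕ) : ℂ) = 0 := by
      rcases h1' with a | a <;> rcases h2' with b | b
      · exact ⟨0, by push_cast; linear_combination (1 / 2) * a - (1 / 2) * b⟩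
      · exact ⟨1, by push_cast; linear_combination (1 / 2) * a - (1 / 2) * b⟩
      · exact ⟨1, by push_cast; linear_combination (1 / 2) * a - (1 / 2) * b⟩
      · exact ⟨2, by push_cast; linear_combination (1 / 2) * a - (1 / 2) * b⟩
    obtain ⟨j, hj⟩ := hkl
    have : k + l + j = 0 := by exact_mod_cast hj
    exact_mod_cast (by omega : k = 0)
  have hμ : μ = 0 ∨ μ = -2 := by simpa [hk] using h1'
  rcases hμ with h | h
  · exact h
  · exfalso
    rcases h2' with b | b
    · have : ((l + 1 : ℕ) : ℂ) = 0 := by push_cast; linear_combination (-1 / 2) * b + (1 / 2) * h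
      exact absurd this (Nat.cast_ne_zero.2 (by omega))
    · have : ((l + 2 : ℕ) : ℂ) = 0 := by push_cast; linear_combination (-1 / 2) * b + (1 / 2) * h
      exact absurd this (Nat.cast_ne_zero.2 (by omega))

/-- `sl₂` acts trivially on the generalized kernel of the Casimir operator. -/
theorem apply_eq_zero_of_casimir_pow [FiniteDimensional ℂ M] (hA : IsSlTwoRightAction E F H)
    {n : ℕ} {v : M} (hn : (casimir E F H ^ n) v = 0) : E v = 0 ∧ F v = 0 ∧ H v = 0 := by
  set N : Submodule ℂ M := LinearMap.ker (casimir E F H ^ n) with hN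
  have hstab : ∀ X : Module.End ℂ M, (∀ u, casimir E F H (X u) = X (casimir E F H u)) →
      ∀ u ∈ N, X u ∈ N := by
    intro X hX u hu
    have hc : Commute (casimir E F H) X := LinearMap.ext hX
    have := (hc.pow_left n).eq
    rw [hN, LinearMap.mem_ker] at hu ⊢
    rw [← Module.End.mul_apply, this, Module.End.mul_apply, hu, map_zero]
  have hHN := hstab H hA.casimir_H
  have hgen : ∀ u : N, ∃ k : ℕ, (H ^ k) (u : M) = 0 := by
    let HN : Module.End ℂ N := H.restrict hHN
    have htop := Module.End.iSup_maxGenEigenspace_eq_top HN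
    have h0 : ∀ μ : ℂ, μ ≠ 0 → HN.maxGenEigenspace μ = ⊥ := by
      intro μ hμ
      by_contra hne
      have hev : HN.HasEigenvalue μ := by
        exact Module.End.HasUnifEigenvalue.lt (k := ⊤) zero_lt_one hne
      obtain ⟨u, hu⟩ := hev.exists_hasEigenvector
      refine hμ (hA.eigenvalue_eq_zero (v := (u : M)) (LinearMap.mem_ker.1 u.2)
        (fun h => hu.2 (Subtype.ext h)) ?_)
      exact congrArg Subtype.val hu.apply_eq_smul
    have h00 : HN.maxGenEigenspace 0 = ⊤ := by
      rw [eq_top_iff, ← htop]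
      refine iSup_le fun μ => ?_
      by_cases hμ : μ = 0
      · rw [hμ]
      · rw [h0 μ hμ]; exact bot_le
    intro u
    have hu : u ∈ HN.maxGenEigenspace 0 := h00 ▸ Submodule.mem_top
    rw [Module.End.mem_maxGenEigenspace] at hu
    obtain ⟨k, hk⟩ := hu
    refine ⟨k, ?_⟩
    rw [zero_smul, sub_zero, show HN = H.restrict hHN from rfl, Module.End.pow_restrict] at hk
    exact congrArg Subtype.val hk
  have hshift : ∀ (X : Module.End ℂ M) (s : ℂ), s ≠ 0 → (∀ u ∈ N, X u ∈ N) →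
      (∀ u, H (X u) = X (H u) + s • X u) → ∀ u ∈ N, X u = 0 := by
    intro X s hs hXN hX u hu
    have key : ∀ k : ℕ, ∀ u ∈ N, (H ^ k) u = 0 → X u = 0 := by
      intro k
      induction k with
      | zero => intro u _ h; simp only [pow_zero, Module.End.one_apply] at h; simp [h]
      | succ k ih =>
        intro u hu h
        have h1 := ih (H u) (hHN u hu) (by rwa [pow_succ, Module.End.mul_apply] at h)
        have h2 := hX u
        rw [h1, zero_add] at h2
        by_contra hne
        exact hs (hA.eigenvalue_eq_zero (LinearMap.mem_ker.1 (hXN u hu)) hne h2)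
    obtain ⟨k, hk⟩ := hgen ⟨u, hu⟩
    exact key k u hu hk
  have hE := hshift E 2 two_ne_zero (hstab E hA.casimir_E) hA.HE
  have hF := hshift F (-2) (by norm_num) (hstab F hA.casimir_F)
    (fun v => by rw [hA.HF, neg_smul, sub_eq_add_neg])
  have hv : v ∈ N := LinearMap.mem_ker.2 hn
  refine ⟨hE v hv, hF v hv, ?_⟩
  have := hA.FE v
  rw [hE v hv, hF v hv] at this
  simpa using this.symm

/-- Whitehead's first lemma for `sl₂`: every 1-cocycle is a coboundary. -/
theorem exists_of_cocycle [FiniteDimensional ℂ M] (hA : IsSlTwoRightAction E F H) {a b c : M}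
    (ha : (2 : ℂ) • a = H a - E c) (hb : (2 : ℂ) • b = F c - H b) (hc : c = F a - E b) :
    ∃ t, E t = a ∧ F t = b ∧ H t = c := by
  set C := casimir E F H with hC
  set t₀ : M := (1 / 2 : ℂ) • H c - E b - F a with ht₀
  have hEc : E c = H a - (2 : ℂ) • a := by rw [ha]; abel
  have hFc : F c = H b + (2 : ℂ) • b := by rw [hb]; abel
  have hEb : E b = F a - c := by rw [hc]; abel
  have hHE : ∀ v, E (H v) = H (E v) - (2 : ℂ) • E v := fun v => by rw [hA.HE]; abel
  have hHF : ∀ v, F (H v) = H (F v) + (2 : ℂ) • F v := fun v => by rw [hA.HF]; abel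
  have hFE : ∀ v, E (F v) = F (E v) - H v := fun v => by rw [hA.FE]; abel
  have ht₀' : t₀ = (1 / 2 : ℂ) • H c + c - (2 : ℂ) • F a := by rw [ht₀, hEb]; module
  have hEt : E t₀ = C a := by
    rw [ht₀', hC, casimir]
    simp only [LinearMap.sub_apply, LinearMap.add_apply, LinearMap.smul_apply,
      Module.End.mul_apply, map_sub, map_add, map_smul, hHE, hFE, hEc]
    module
  have hFt : F t₀ = C b := by
    rw [ht₀', hC, casimir]
    have hFFa : F (E b) = F (F a) - F c := by rw [hEb, map_sub]
    simp only [LinearMap.sub_apply, LinearMap.add_apply, LinearMap.smul_apply,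
      Module.End.mul_apply, map_sub, map_add, map_smul, hHF, hFFa, hFc]
    module
  have hHt : H t₀ = C c := by
    rw [ht₀', hC, casimir]
    have hFEc : F (E c) = F (H a) - (2 : ℂ) • F a := by rw [hEc, map_sub, map_smul]
    simp only [LinearMap.sub_apply, LinearMap.add_apply, LinearMap.smul_apply,
      Module.End.mul_apply, map_sub, map_add, map_smul, hFEc, hHF]
    module
  have hCE : Commute C E := LinearMap.ext hA.casimir_E
  have hCF : Commute C F := LinearMap.ext hA.casimir_F
  have hCH : Commute C H := LinearMap.ext hA.casimir_H
  have haeval : ∀ (X : Module.End ℂ M), Commute C X → ∀ (p : Polynomial ℂ) (v : M),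
      Polynomial.aeval C p (X v) = X (Polynomial.aeval C p v) := by
    intro X hX p v
    exact LinearMap.congr_fun (Algebra.commute_of_mem_adjoin_singleton_of_commute
      (Polynomial.aeval_mem_adjoin_singleton ℂ C) hX.symm).symm.eq v
  obtain ⟨q, hq, hq0⟩ := Polynomial.exists_eq_pow_rootMultiplicity_mul_and_not_dvd
    (minpoly ℂ C) (minpoly.ne_zero (Algebra.IsIntegral.isIntegral C)) 0
  set n := (minpoly ℂ C).rootMultiplicity 0
  rw [map_zero, sub_zero] at hq hq0
  have hker : ∀ v, (C ^ n) (Polynomial.aeval C q v) = 0 := by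
    intro v
    have := minpoly.aeval ℂ C
    rw [hq, map_mul, map_pow, Polynomial.aeval_X] at this
    simpa using LinearMap.congr_fun this v
  have ha0 : Polynomial.aeval C q a = 0 := by
    have h := congrArg (Polynomial.aeval C q) ha
    rw [map_sub, map_smul, haeval H hCH, haeval E hCE,
      (hA.apply_eq_zero_of_casimir_pow (hker a)).2.2,
      (hA.apply_eq_zero_of_casimir_pow (hker c)).1] at h
    simpa using h
  have hb0 : Polynomial.aeval C q b = 0 := by
    have h := congrArg (Polynomial.aeval C q) hb
    rw [map_sub, map_smul, haeval H hCH, haeval F hCF,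
      (hA.apply_eq_zero_of_casimir_pow (hker b)).2.2,
      (hA.apply_eq_zero_of_casimir_pow (hker c)).2.1] at h
    simpa using h
  have hc0 : Polynomial.aeval C q c = 0 := by
    have h := congrArg (Polynomial.aeval C q) hc
    rw [map_sub, haeval F hCF, haeval E hCE,
      (hA.apply_eq_zero_of_casimir_pow (hker a)).2.1,
      (hA.apply_eq_zero_of_casimir_pow (hker b)).1] at h
    simpa using h
  have hq00 : q.coeff 0 ≠ 0 := fun h => hq0 (Polynomial.X_dvd_iff.2 h)
  have hdiv : ∀ v, Polynomial.aeval C q v = 0 →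
      -(q.coeff 0)⁻¹ • Polynomial.aeval C q.divX (C v) = v := by
    intro v hv
    rw [← Polynomial.divX_mul_X_add q, map_add, map_mul, Polynomial.aeval_X, Polynomial.aeval_C,
      LinearMap.add_apply, Module.End.mul_apply, Module.algebraMap_end_apply] at hv
    rw [eq_neg_of_add_eq_zero_left hv, smul_neg, neg_smul, neg_neg, smul_smul,
      inv_mul_cancel₀ hq00, one_smul]
  refine ⟨-(q.coeff 0)⁻¹ • Polynomial.aeval C q.divX t₀, ?_, ?_, ?_⟩
  · rw [map_smul, ← haeval E hCE, hEt, hdiv a ha0]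
  · rw [map_smul, ← haeval F hCF, hFt, hdiv b hb0]
  · rw [map_smul, ← haeval H hCH, hHt, hdiv c hc0]

end IsSlTwoRightAction

end SlTwoOperators

section Algebra

variable {m : ℕ}

/-- Evaluation of a coordinate. -/
def coordₗ (i : BasisIdx m) : Lm m →ₗ[ℂ] ℂ where
  toFun v := v i
  map_add' _ _ := rfl
  map_smul' _ _ := rfl

theorem coordₗ_bas (i j : BasisIdx m) : coordₗ i (bas m j) = if i = j then 1 else 0 :=
  Pi.single_apply ..

theorem Lm.eq_sum (v : Lm m) : v = ∑ i, coordₗ i v • bas m i := by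
  funext j
  change coordₗ j v = coordₗ j (∑ i, coordₗ i v • bas m i)
  simp only [map_sum, map_smul, coordₗ_bas, smul_eq_mul, mul_ite, mul_one, mul_zero]
  rw [Finset.sum_ite_eq, if_pos (Finset.mem_univ _)]

theorem Lm.linearMap_ext {V : Type*} [AddCommGroup V] [Module ℂ V] {f g : Lm m →ₗ[ℂ] V}
    (h : ∀ i, f (bas m i) = g (bas m i)) : f = g := by
  ext v
  rw [Lm.eq_sum v]
  simp only [map_sum, map_smul, h]

/-- The bracket as a bilinear map. -/
noncomputable def brₗ (m : ℕ) : Lm m →ₗ[ℂ] Lm m →ₗ[ℂ] Lm m :=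
  LinearMap.mk₂ ℂ (br m)
    (fun x x' y => by
      simp only [br, ← sum_add_distrib, ← add_smul, ← add_mul]; rfl)
    (fun c x y => by
      simp only [br, smul_sum, smul_smul, ← mul_assoc]; rfl)
    (fun x y y' => by
      simp only [br, ← sum_add_distrib, ← add_smul, ← mul_add]; rfl)
    (fun c x y => by
      simp only [br, smul_sum, smul_smul, mul_left_comm c]; rfl)

theorem br_eq (x y : Lm m) : br m x y = brₗ m x y := rfl

theorem brₗ_bas (i j : BasisIdx m) : brₗ m (bas m i) (bas m j) = sc m i j := by
  rw [← br_eq, br]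
  simp [bas, Pi.single_apply]

/-- The element `e` of the algebra. -/
noncomputable abbrev eₗ (m : ℕ) : Lm m := bas m (Sum.inl 0)
/-- The element `f` of the algebra. -/
noncomputable abbrev fₗ (m : ℕ) : Lm m := bas m (Sum.inl 1)
/-- The element `h` of the algebra. -/
noncomputable abbrev hₗ (m : ℕ) : Lm m := bas m (Sum.inl 2)

/-- The element `x_k`, zero for `k > m`. -/
noncomputable def xₗ (m k : ℕ) : Lm m :=
  if h : k < m + 1 then bas m (Sum.inr ⟨k, h⟩) else 0

theorem bas_inr (k : Fin (m + 1)) : bas m (Sum.inr k) = xₗ m k := by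
  rw [xₗ, dif_pos k.isLt]

@[simp] theorem brₗ_x_e (k : ℕ) :
    brₗ m (xₗ m k) (eₗ m) = (-((k : ℂ) * ((m : ℂ) + 1 - (k : ℂ)))) • xₗ m (k - 1) := by
  by_cases h : k < m + 1
  · rw [xₗ, xₗ, dif_pos h, dif_pos (by omega), brₗ_bas]
    rfl
  · by_cases h' : k = m + 1
    · simp [xₗ, h']
    · simp [xₗ, h, show ¬ k - 1 < m + 1 by omega]

@[simp] theorem brₗ_x_f (k : ℕ) : brₗ m (xₗ m k) (fₗ m) = xₗ m (k + 1) := by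
  by_cases h : k < m + 1
  · rw [xₗ, xₗ, dif_pos h, brₗ_bas]
    simp only [Nat.add_lt_add_iff_right]
    rfl
  · simp [xₗ, h, show ¬ k < m by omega]

@[simp] theorem brₗ_x_h (k : ℕ) :
    brₗ m (xₗ m k) (hₗ m) = ((m : ℂ) - 2 * (k : ℂ)) • xₗ m k := by
  by_cases h : k < m + 1
  · rw [xₗ, dif_pos h, brₗ_bas]
    rfl
  · simp [xₗ, h]

@[simp] theorem brₗ_x_right (x : Lm m) (k : ℕ) : brₗ m x (xₗ m k) = 0 := by
  have : (brₗ m).flip (xₗ m k) = 0 := by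
    refine Lm.linearMap_ext fun i => ?_
    by_cases h : k < m + 1
    · rcases i with i | i
      · fin_cases i <;> simp [xₗ, h, brₗ_bas, sc]
      · simp [xₗ, h, brₗ_bas, sc]
    · simp [xₗ, h]
  exact LinearMap.congr_fun this x

@[simp] theorem brₗ_e_e : brₗ m (eₗ m) (eₗ m) = 0 := by rw [brₗ_bas]; rfl
@[simp] theorem brₗ_f_f : brₗ m (fₗ m) (fₗ m) = 0 := by rw [brₗ_bas]; rfl
@[simp] theorem brₗ_h_h : brₗ m (hₗ m) (hₗ m) = 0 := by rw [brₗ_bas]; rfl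
@[simp] theorem brₗ_e_h : brₗ m (eₗ m) (hₗ m) = (2 : ℂ) • eₗ m := by rw [brₗ_bas]; rfl
@[simp] theorem brₗ_h_e : brₗ m (hₗ m) (eₗ m) = (-2 : ℂ) • eₗ m := by rw [brₗ_bas]; rfl
@[simp] theorem brₗ_h_f : brₗ m (hₗ m) (fₗ m) = (2 : ℂ) • fₗ m := by rw [brₗ_bas]; rfl
@[simp] theorem brₗ_f_h : brₗ m (fₗ m) (hₗ m) = (-2 : ℂ) • fₗ m := by rw [brₗ_bas]; rfl
@[simp] theorem brₗ_e_f : brₗ m (eₗ m) (fₗ m) = hₗ m := by rw [brₗ_bas]; rfl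
@[simp] theorem brₗ_f_e : brₗ m (fₗ m) (eₗ m) = -hₗ m := by rw [brₗ_bas]; rfl

theorem Lm.linearMap_ext' {V : Type*} [AddCommGroup V] [Module ℂ V] {f g : Lm m →ₗ[ℂ] V}
    (he : f (eₗ m) = g (eₗ m)) (hf : f (fₗ m) = g (fₗ m)) (hh : f (hₗ m) = g (hₗ m))
    (hx : ∀ k, f (xₗ m k) = g (xₗ m k)) : f = g := by
  refine Lm.linearMap_ext fun i => ?_
  rcases i with i | i
  · fin_cases i
    · exact he
    · exact hf
    · exact hh
  · rw [bas_inr]; exact hx _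

/-- The projection of `L` onto `sl₂` along the ideal `I`. -/
noncomputable def projₗ (m : ℕ) : Lm m →ₗ[ℂ] Lm m :=
  (coordₗ (Sum.inl 0)).smulRight (eₗ m) + (coordₗ (Sum.inl 1)).smulRight (fₗ m) +
    (coordₗ (Sum.inl 2)).smulRight (hₗ m)

theorem projₗ_apply (v : Lm m) :
    projₗ m v = coordₗ (Sum.inl 0) v • eₗ m + coordₗ (Sum.inl 1) v • fₗ m +
      coordₗ (Sum.inl 2) v • hₗ m := rfl

@[simp] theorem projₗ_e : projₗ m (eₗ m) = eₗ m := by simp [projₗ_apply, coordₗ_bas]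
@[simp] theorem projₗ_f : projₗ m (fₗ m) = fₗ m := by simp [projₗ_apply, coordₗ_bas]
@[simp] theorem projₗ_h : projₗ m (hₗ m) = hₗ m := by simp [projₗ_apply, coordₗ_bas]
@[simp] theorem projₗ_x (k : ℕ) : projₗ m (xₗ m k) = 0 := by
  by_cases h : k < m + 1 <;> simp [projₗ_apply, coordₗ_bas, xₗ, h]

theorem brₗ_projₗ (x y : Lm m) : brₗ m x (projₗ m y) = brₗ m x y := by
  have : brₗ m x ∘ₗ projₗ m = brₗ m x := by
    apply Lm.linearMap_ext' <;> simp
  exact LinearMap.congr_fun this y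

theorem projₗ_projₗ (x : Lm m) : projₗ m (projₗ m x) = projₗ m x := by
  simp only [projₗ_apply x, map_add, map_smul, projₗ_e, projₗ_f, projₗ_h]

/-- Linear maps on `L` that agree on `e`, `f`, `h` agree on the image of the projection. -/
theorem projₗ_ext {V : Type*} [AddCommGroup V] [Module ℂ V] {f g : Lm m →ₗ[ℂ] V}
    (he : f (eₗ m) = g (eₗ m)) (hf : f (fₗ m) = g (fₗ m)) (hh : f (hₗ m) = g (hₗ m)) (v : Lm m) :
    f (projₗ m v) = g (projₗ m v) := by
  simp only [projₗ_apply, map_add, map_smul, he, hf, hh]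

theorem projₗ_brₗ (x y : Lm m) : projₗ m (brₗ m x y) = brₗ m (projₗ m x) y := by
  have h : ∀ y : Lm m, projₗ m (brₗ m x y) = brₗ m (projₗ m x) y ↔
      (projₗ m ∘ₗ (brₗ m).flip y) x = ((brₗ m).flip y ∘ₗ projₗ m) x := fun y => Iff.rfl
  rw [← brₗ_projₗ x y, ← brₗ_projₗ (projₗ m x) y]
  refine projₗ_ext (f := projₗ m ∘ₗ brₗ m x) (g := brₗ m (projₗ m x)) ?_ ?_ ?_ y <;>
  · refine (h _).2 (LinearMap.congr_fun (Lm.linearMap_ext' ?_ ?_ ?_ ?_) x) <;> simp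

theorem projₗ_eq_of_brₗ {u v : Lm m} (h : ∀ x, brₗ m x u = brₗ m x v) :
    projₗ m u = projₗ m v := by
  have h1 := h (hₗ m)
  have h2 := h (eₗ m)
  rw [← brₗ_projₗ _ u, ← brₗ_projₗ _ v, projₗ_apply, projₗ_apply] at h1 h2
  simp only [map_add, map_smul, brₗ_h_h, brₗ_h_e, brₗ_h_f, brₗ_e_e, brₗ_e_f, brₗ_e_h] at h1 h2
  have a := congrArg (coordₗ (Sum.inl 0)) h1
  have b := congrArg (coordₗ (Sum.inl 1)) h1
  have c := congrArg (coordₗ (Sum.inl 0)) h2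
  simp [coordₗ_bas] at a b c
  rw [projₗ_apply, projₗ_apply, a, b, c]

theorem isSlTwoRightAction_brₗ :
    IsSlTwoRightAction ((brₗ m).flip (eₗ m)) ((brₗ m).flip (fₗ m)) ((brₗ m).flip (hₗ m)) := by
  have h : ∀ {A B : Module.End ℂ (Lm m)}, A (eₗ m) = B (eₗ m) → A (fₗ m) = B (fₗ m) →
      A (hₗ m) = B (hₗ m) → (∀ k, A (xₗ m k) = B (xₗ m k)) → ∀ v, A v = B v :=
    fun he hf hh hx v => LinearMap.congr_fun (Lm.linearMap_ext' he hf hh hx) v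
  let E := (brₗ m).flip (eₗ m)
  let F := (brₗ m).flip (fₗ m)
  let H := (brₗ m).flip (hₗ m)
  constructor
  · refine h (A := H * E) (B := E * H + (2 : ℂ) • E) ?_ ?_ ?_ fun k => ?_
    all_goals simp [E, H]
    rcases k with _ | k
    · simp
    · push_cast
      module
  · refine h (A := H * F) (B := F * H - (2 : ℂ) • F) ?_ ?_ ?_ fun k => ?_
    all_goals simp [F, H]
    module
  · refine h (A := F * E) (B := E * F + H) ?_ ?_ ?_ fun k => ?_
    all_goals simp [E, F, H]
    rcases k with _ | k
    · simp
    · push_cast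
      module

theorem brₗ_leibniz (x y z : Lm m) :
    brₗ m x (brₗ m y z) = brₗ m (brₗ m x y) z - brₗ m (brₗ m x z) y := by
  have hEH := (isSlTwoRightAction_brₗ (m := m)).HE x
  have hHF := (isSlTwoRightAction_brₗ (m := m)).HF x
  have hFE := (isSlTwoRightAction_brₗ (m := m)).FE x
  simp only [LinearMap.flip_apply] at hEH hHF hFE
  rw [← brₗ_projₗ x (brₗ m y z), projₗ_brₗ, ← brₗ_projₗ _ z, ← brₗ_projₗ _ y,
    ← brₗ_projₗ _ z, ← brₗ_projₗ _ y, ← brₗ_projₗ _ z]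
  simp only [projₗ_apply, map_add, map_smul, LinearMap.add_apply, LinearMap.smul_apply, brₗ_e_e,
    brₗ_f_f, brₗ_h_h, brₗ_e_h, brₗ_h_e, brₗ_h_f, brₗ_f_h, brₗ_e_f, brₗ_f_e, hEH, hHF, hFE,
    map_neg, map_zero]
  module

end Algebra

section SlTwoConstructions

variable {M : Type*} [AddCommGroup M] [Module ℂ M] {E F H : Module.End ℂ M}

/-- The commutator action of an operator on endomorphisms. -/
noncomputable def commₗ (X : Module.End ℂ M) : Module.End ℂ (Module.End ℂ M) :=
  LinearMap.mulLeft ℂ X - LinearMap.mulRight ℂ X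

theorem commₗ_apply (X ψ : Module.End ℂ M) (v : M) : commₗ X ψ v = X (ψ v) - ψ (X v) := rfl

theorem IsSlTwoRightAction.commₗ (hA : IsSlTwoRightAction E F H) :
    IsSlTwoRightAction (commₗ E) (commₗ F) (commₗ H) := by
  constructor <;> intro ψ <;> ext v <;>
    simp only [commₗ_apply, LinearMap.add_apply, LinearMap.sub_apply, LinearMap.smul_apply,
      hA.HE, hA.HF, hA.FE, map_sub, map_add, map_smul] <;> module

theorem IsSlTwoRightAction.mapQ (hA : IsSlTwoRightAction E F H) (N : Submodule ℂ M)
    (hE : N ≤ N.comap E) (hF : N ≤ N.comap F) (hH : N ≤ N.comap H) :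
    IsSlTwoRightAction (N.mapQ N E hE) (N.mapQ N F hF) (N.mapQ N H hH) := by
  constructor <;> intro v <;> obtain ⟨v, rfl⟩ := N.mkQ_surjective v <;>
    simp only [Submodule.mkQ_apply, Submodule.mapQ_apply, ← Submodule.Quotient.mk_add,
      ← Submodule.Quotient.mk_sub, ← Submodule.Quotient.mk_smul, hA.HE, hA.HF, hA.FE]

end SlTwoConstructions

section Cohomology

variable {m : ℕ} {φ : Lm m →ₗ[ℂ] Lm m →ₗ[ℂ] Lm m}

/-- The Leibniz 2-cocycle condition. -/
def IsTwoCocycle (φ : Lm m →ₗ[ℂ] Lm m →ₗ[ℂ] Lm m) : Prop :=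
  ∀ x y z : Lm m,
    brₗ m x (φ y z) - brₗ m (φ x y) z + brₗ m (φ x z) y +
      φ x (brₗ m y z) - φ (brₗ m x y) z + φ (brₗ m x z) y = 0

/-- The Leibniz 2-coboundary of a linear map. -/
noncomputable def coboundary (d : Module.End ℂ (Lm m)) : Lm m →ₗ[ℂ] Lm m →ₗ[ℂ] Lm m :=
  brₗ m ∘ₗ d + (brₗ m).compl₂ d - (brₗ m).compr₂ d

theorem coboundary_apply (d : Module.End ℂ (Lm m)) (x y : Lm m) :
    coboundary d x y = brₗ m (d x) y + brₗ m x (d y) - d (brₗ m x y) := rfl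

theorem isTwoCocycle_coboundary (d : Module.End ℂ (Lm m)) : IsTwoCocycle (coboundary d) := by
  intro x y z
  simp only [coboundary_apply, map_add, map_sub, LinearMap.add_apply, LinearMap.sub_apply,
    brₗ_leibniz]
  abel

theorem IsTwoCocycle.sub {φ' : Lm m →ₗ[ℂ] Lm m →ₗ[ℂ] Lm m} (h : IsTwoCocycle φ)
    (h' : IsTwoCocycle φ') : IsTwoCocycle (φ - φ') := by
  intro x y z
  have := congrArg₂ (· - ·) (h x y z) (h' x y z)
  simp only [sub_zero] at this
  rw [← this]
  simp only [LinearMap.sub_apply, map_sub]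
  abel

/-- Modulo right multiplications, a cocycle restricted to `sl₂` is a 1-coboundary with values in
the endomorphisms of `L`. -/
theorem IsTwoCocycle.exists_end (h : IsTwoCocycle φ) :
    ∃ T : Module.End ℂ (Lm m),
      (∃ s, ∀ x, (φ - coboundary T) x (eₗ m) = brₗ m x s) ∧
      (∃ s, ∀ x, (φ - coboundary T) x (fₗ m) = brₗ m x s) ∧
      (∃ s, ∀ x, (φ - coboundary T) x (hₗ m) = brₗ m x s) := by
  let R : Lm m →ₗ[ℂ] Module.End ℂ (Lm m) := (brₗ m).flip
  let N : Submodule ℂ (Module.End ℂ (Lm m)) := LinearMap.range R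
  have hN : ∀ z, N ≤ N.comap (commₗ (R z)) := by
    rintro z _ ⟨a, rfl⟩
    exact ⟨brₗ m a z, LinearMap.ext fun x => brₗ_leibniz x a z⟩
  have hA := (isSlTwoRightAction_brₗ (m := m)).commₗ.mapQ N (hN _) (hN _) (hN _)
  have hmk : ∀ y z, (N.mkQ (φ.flip (brₗ m y z))) =
      N.mapQ N _ (hN z) (N.mkQ (φ.flip y)) - N.mapQ N _ (hN y) (N.mkQ (φ.flip z)) := by
    intro y z
    rw [Submodule.mkQ_apply, Submodule.mkQ_apply, Submodule.mkQ_apply, Submodule.mapQ_apply,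
      Submodule.mapQ_apply, ← Submodule.Quotient.mk_sub, Submodule.Quotient.eq]
    refine ⟨-φ y z, LinearMap.ext fun x => ?_⟩
    have := h x y z
    simp only [R, commₗ_apply, LinearMap.sub_apply, LinearMap.flip_apply, map_neg,
      LinearMap.neg_apply] at this ⊢
    rw [← sub_eq_zero, ← neg_eq_zero, ← this]
    abel
  obtain ⟨t, hte, htf, hth⟩ := hA.exists_of_cocycle (a := N.mkQ (φ.flip (eₗ m)))
    (b := N.mkQ (φ.flip (fₗ m))) (c := N.mkQ (φ.flip (hₗ m)))
    (by rw [← map_smul, ← map_smul, ← brₗ_e_h]; exact hmk _ _)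
    (by rw [← map_smul, ← map_smul, ← brₗ_h_f]; exact hmk _ _)
    (by nth_rw 1 [← brₗ_e_f]; exact hmk _ _)
  obtain ⟨T, rfl⟩ := N.mkQ_surjective t
  have key : ∀ y, N.mapQ N _ (hN y) (N.mkQ T) = N.mkQ (φ.flip y) →
      ∃ s, ∀ x, (φ - coboundary T) x y = brₗ m x s := by
    intro y hy
    rw [Submodule.mkQ_apply, Submodule.mkQ_apply, Submodule.mapQ_apply, eq_comm,
      Submodule.Quotient.eq] at hy
    obtain ⟨s, hs⟩ := hy
    refine ⟨s - T y, fun x => ?_⟩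
    have := LinearMap.congr_fun hs x
    simp only [R, commₗ_apply, LinearMap.sub_apply, LinearMap.flip_apply] at this
    rw [map_sub, this, LinearMap.sub_apply, LinearMap.sub_apply, coboundary_apply]
    abel
  exact ⟨T, key _ hte, key _ htf, key _ hth⟩

theorem IsTwoCocycle.projₗ_eq_zero (h : IsTwoCocycle φ) {y z s t r : Lm m}
    (hy : ∀ x, φ x y = brₗ m x s) (hz : ∀ x, φ x z = brₗ m x t)
    (hyz : ∀ x, φ x (brₗ m y z) = brₗ m x r) :
    projₗ m (brₗ m y t + brₗ m z s + brₗ m t y + r) = 0 := by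
  rw [← map_zero (projₗ m)]
  refine projₗ_eq_of_brₗ fun x => ?_
  have := h x y z
  rw [hyz, hy, hy, hz, hz, hz] at this
  rw [map_zero, ← this]
  simp only [map_add, brₗ_leibniz]
  abel

/-- Up to a coboundary, a 2-cocycle vanishes when its second argument lies in `sl₂`. -/
theorem IsTwoCocycle.exists_eq_on_projₗ (h : IsTwoCocycle φ) :
    ∃ T : Module.End ℂ (Lm m), ∀ x y, (φ - coboundary T) x (projₗ m y) = 0 := by
  obtain ⟨T, ⟨u, hu⟩, ⟨v, hv⟩, ⟨w, hw⟩⟩ := h.exists_end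
  have h' := h.sub (isTwoCocycle_coboundary T)
  set φ' := φ - coboundary T with hφ'
  have heh := h'.projₗ_eq_zero (r := (2 : ℂ) • u) hu hw (by simp [hu])
  have hef := h'.projₗ_eq_zero (r := w) hu hv (by simp [hw])
  have hhf := h'.projₗ_eq_zero (r := (2 : ℂ) • v) hw hv (by simp [hv])
  have expand : ∀ a b c d : Lm m, projₗ m (brₗ m a b + brₗ m c d + brₗ m b a) =
      brₗ m (projₗ m a) (projₗ m b) + brₗ m (projₗ m c) (projₗ m d) +
        brₗ m (projₗ m b) (projₗ m a) := by
    intro a b c d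
    simp only [map_add, projₗ_brₗ, brₗ_projₗ]
  rw [map_add, expand, map_smul] at heh hhf
  rw [map_add, expand] at hef
  simp only [projₗ_e, projₗ_f, projₗ_h] at heh hef hhf
  rw [projₗ_apply u] at heh hef
  rw [projₗ_apply v] at hef hhf
  rw [projₗ_apply w] at heh hhf hef
  have c1 := congrArg (coordₗ (Sum.inl 1)) heh
  have c2 := congrArg (coordₗ (Sum.inl 2)) heh
  have d0 := congrArg (coordₗ (Sum.inl 0)) hef
  have d1 := congrArg (coordₗ (Sum.inl 1)) hef
  have d2 := congrArg (coordₗ (Sum.inl 2)) hef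
  have g0 := congrArg (coordₗ (Sum.inl 0)) hhf
  have g1 := congrArg (coordₗ (Sum.inl 1)) hhf
  have g2 := congrArg (coordₗ (Sum.inl 2)) hhf
  simp [coordₗ_bas] at c1 c2 d0 d1 d2 g0 g1 g2
  set μ := coordₗ (Sum.inl 0) u
  have hu' : projₗ m u = μ • eₗ m := by
    rw [projₗ_apply, c2, show coordₗ (Sum.inl 1) u = 0 by linear_combination c1 / 4]
    module
  have hw' : projₗ m w = μ • hₗ m := by
    rw [projₗ_apply, d0, show coordₗ (Sum.inl 1) w = 0 by linear_combination d1 + 2 * c2,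
      show coordₗ (Sum.inl 2) w = μ by linear_combination d2]
    module
  have hv' : projₗ m v = μ • fₗ m := by
    rw [projₗ_apply, g0, show coordₗ (Sum.inl 1) v = μ by linear_combination g1 / 2 + d2,
      show coordₗ (Sum.inl 2) v = 0 by linear_combination g2 / 2 + d0 / 2]
    module
  refine ⟨T + μ • (1 : Module.End ℂ (Lm m)), fun x y => ?_⟩
  have hT : ∀ y, (φ - coboundary (T + μ • (1 : Module.End ℂ (Lm m)))) x y = (φ' x - μ • brₗ m x) y := by
    intro y
    simp only [hφ', LinearMap.sub_apply, coboundary_apply, LinearMap.add_apply,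
      LinearMap.smul_apply, Module.End.one_apply, map_add, map_smul]
    module
  rw [hT]
  refine projₗ_ext (g := 0) ?_ ?_ ?_ y
  · rw [LinearMap.sub_apply, hu, ← brₗ_projₗ, hu']
    simp
  · rw [LinearMap.sub_apply, hv, ← brₗ_projₗ, hv']
    simp
  · rw [LinearMap.sub_apply, hw, ← brₗ_projₗ, hw']
    simp

/-- A 2-cocycle vanishing when its second argument lies in `sl₂` is a coboundary. -/
theorem IsTwoCocycle.exists_coboundary_of_projₗ (hm : m ≠ 0) (h : IsTwoCocycle φ)
    (h0 : ∀ x y, φ x (projₗ m y) = 0) : ∃ d, φ = coboundary d := by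
  have hmC : (m : ℂ) ≠ 0 := Nat.cast_ne_zero.2 hm
  have hx : ∀ x y k, φ x (brₗ m (xₗ m k) (projₗ m y)) = -brₗ m x (φ (projₗ m y) (xₗ m k)) := by
    intro x y k
    have h1 := h x (projₗ m y) (xₗ m k)
    have h2 := h x (xₗ m k) (projₗ m y)
    simp only [h0, brₗ_x_right, map_zero, LinearMap.zero_apply] at h1 h2
    linear_combination (norm := module) h1 + h2
  have hθ : ∀ k : Fin (m + 1), ∃ θ, ∀ x, φ x (bas m (Sum.inr k)) = brₗ m x θ := by
    rintro ⟨k, hk⟩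
    rw [bas_inr]
    rcases k with _ | k
    · refine ⟨-(m : ℂ)⁻¹ • φ (hₗ m) (xₗ m 0), fun x => ?_⟩
      have := hx x (hₗ m) 0
      simp only [projₗ_h, brₗ_x_h, Nat.cast_zero, mul_zero, sub_zero, map_smul] at this
      rw [map_smul, neg_smul, ← smul_neg, ← this, smul_smul, inv_mul_cancel₀ hmC, one_smul]
    · refine ⟨-φ (fₗ m) (xₗ m k), fun x => ?_⟩
      have := hx x (fₗ m) k
      rwa [projₗ_f, brₗ_x_f, ← map_neg] at this
  choose θ hθ using hθ
  let d : Module.End ℂ (Lm m) :=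
    ∑ k : Fin (m + 1), (coordₗ (Sum.inr k)).smulRight (projₗ m (θ k))
  have hd : ∀ v, d v = ∑ k : Fin (m + 1), coordₗ (Sum.inr k) v • projₗ m (θ k) := fun v => by
    simp [d]
  have hPd : ∀ v, projₗ m (d v) = d v := fun v => by
    simp only [hd, map_sum, map_smul, projₗ_projₗ]
  have hdP : ∀ v, d (projₗ m v) = 0 := fun v => by
    simp [hd, projₗ_apply, coordₗ_bas]
  have hφ : ∀ x y, φ x y = brₗ m x (d y) := by
    intro x y
    refine LinearMap.congr_fun (f := φ x) (g := brₗ m x ∘ₗ d) (Lm.linearMap_ext fun i => ?_) y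
    rcases i with i | k
    · have hi : projₗ m (bas m (Sum.inl i)) = bas m (Sum.inl i) := by
        fin_cases i <;> simp [projₗ_apply, coordₗ_bas]
      rw [← hi, h0, LinearMap.comp_apply, hdP, map_zero]
    · rw [LinearMap.comp_apply, hθ, hd]
      simp [coordₗ_bas, brₗ_projₗ]
  have hd_brₗ : ∀ x y, d (brₗ m x y) = brₗ m (d x) y := by
    intro x y
    rw [← brₗ_projₗ x y, ← brₗ_projₗ (d x) y, ← hPd, ← hPd x, ← projₗ_brₗ]
    refine projₗ_eq_of_brₗ fun x' => ?_
    have := h x' x (projₗ m y)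
    simp only [h0, map_zero, hφ, LinearMap.zero_apply] at this
    rw [brₗ_leibniz, ← sub_eq_zero, ← this, brₗ_projₗ]
    simp only [brₗ_projₗ]
    abel
  refine ⟨d, LinearMap.ext fun x => LinearMap.ext fun y => ?_⟩
  rw [coboundary_apply, hφ, hd_brₗ]
  abel

end Cohomology

/-- For the complex `(m+4)`-dimensional simple Leibniz algebra `L = sl₂ ∔ I` of
Theorem 2.3 (`m ≥ 2`), `HL²(L,L) = 0`: every Leibniz 2-cocycle of `L` with
coefficients in itself is a Leibniz 2-coboundary. -/
theorem stmt19 (m : ℕ) (hm : 2 ≤ m)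
    (φ : Lm m →ₗ[ℂ] Lm m →ₗ[ℂ] Lm m)
    (hcoc : ∀ x y z : Lm m,
      br m x (φ y z) - br m (φ x y) z + br m (φ x z) y +
        φ x (br m y z) - φ (br m x y) z + φ (br m x z) y = 0) :
    ∃ d : Lm m →ₗ[ℂ] Lm m,
      ∀ x y : Lm m, φ x y = br m (d x) y + br m x (d y) - d (br m x y) := by
  have h : IsTwoCocycle φ := hcoc
  obtain ⟨T, hT⟩ := h.exists_eq_on_projₗ
  obtain ⟨d, hd⟩ := (h.sub (isTwoCocycle_coboundary T)).exists_coboundary_of_projₗ (by omega) hT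
  refine ⟨T + d, fun x y => ?_⟩
  have := LinearMap.congr_fun (LinearMap.congr_fun hd x) y
  rw [LinearMap.sub_apply, LinearMap.sub_apply, sub_eq_iff_eq_add] at this
  rw [this]
  simp only [coboundary_apply, br_eq, LinearMap.add_apply, map_add]
  abel
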